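/- arXiv:1707.05418 — 2 statements merged into one kernel-verified Lean document; each statement's English description precedes it below -/
import Mathlib

section
/- Let Φψ : ℕ → Matrix (Fin q) (Fin m) ℝ, θ ≥ 0, α ≥ 0, and t_a ∈ ℕ. Suppose d : ℕ → (Fin m → ℝ) satisfies: d(k) = 0 for all k > i where i ≤ t_a, |d(k)| ≤ α for all k, and |(Φψ * d)(τ)| ≤ θ for all τ ≤ t_a. Let s = t_a − i and define the delayed signal dₛ by dₛ(k) = d(k − s) for k ≥ s and dₛ(k) = 0 for k < s. Then dₛ(k) = 0 for all k > t_a, |dₛ(k)| ≤ α for all k, and |(Φψ * dₛ)(τ)| ≤ θ for all τ ≤ t_a. -/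
/-- Causal convolution of a kernel `Φ` with a signal `d`:
`(Φ * d)(n) = ∑_{k=0}^{n} Φ(n−k) · d(k)`. -/
noncomputable def conv {q m : ℕ} (Φ : ℕ → Matrix (Fin q) (Fin m) ℝ)
    (d : ℕ → Fin m → ℝ) (n : ℕ) : Fin q → ℝ :=
  ∑ k ∈ Finset.range (n + 1), (Φ (n - k)).mulVec (d k)

theorem conv_eq_zero_of_forall_le {q m : ℕ} (Φ : ℕ → Matrix (Fin q) (Fin m) ℝ)
    (d : ℕ → Fin m → ℝ) (n : ℕ) (h : ∀ k, k ≤ n → d k = 0) : conv Φ d n = 0 :=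
  Finset.sum_eq_zero fun k hk => by
    rw [h k (Nat.lt_succ_iff.mp (Finset.mem_range.mp hk)), Matrix.mulVec_zero]

/-- Causal convolution commutes with a delay by `s`. -/
theorem conv_delay_add {q m : ℕ} (Φ : ℕ → Matrix (Fin q) (Fin m) ℝ)
    (d : ℕ → Fin m → ℝ) (s n : ℕ) (e : ℕ → Fin m → ℝ)
    (he : ∀ k, e k = if k < s then 0 else d (k - s)) :
    conv Φ e (s + n) = conv Φ d n := by
  unfold conv
  rw [add_assoc, Finset.sum_range_add, Finset.sum_eq_zero, zero_add]
  · refine Finset.sum_congr rfl fun k _ => ?_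
    simp [he, Nat.add_sub_add_left]
  · intro k hk
    rw [he, if_pos (Finset.mem_range.mp hk), Matrix.mulVec_zero]

/-- Delaying a feasible attack (supported on `{0,…,i}` with `i ≤ t_a`) by
`s = t_a − i` preserves feasibility: support in `{0,…,t_a}`, magnitude bound `α`,
and stealthiness `|(Φψ * d)(τ)| ≤ θ` for all `τ ≤ t_a`. -/
theorem delayed_attack_feasible {q m : ℕ}
    (Φψ : ℕ → Matrix (Fin q) (Fin m) ℝ) (θ α : ℝ)
    (hθ : 0 ≤ θ) (hα : 0 ≤ α) (t_a i : ℕ) (hi : i ≤ t_a)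
    (d : ℕ → Fin m → ℝ)
    (hsupp : ∀ k, i < k → d k = 0)
    (hmag : ∀ k, ‖d k‖ ≤ α)
    (hstealth : ∀ τ, τ ≤ t_a → ‖conv Φψ d τ‖ ≤ θ)
    (ds : ℕ → Fin m → ℝ)
    (hds : ∀ k, ds k = if k < t_a - i then 0 else d (k - (t_a - i))) :
    (∀ k, t_a < k → ds k = 0) ∧
    (∀ k, ‖ds k‖ ≤ α) ∧
    (∀ τ, τ ≤ t_a → ‖conv Φψ ds τ‖ ≤ θ) := by
  refine ⟨fun k hk => ?_, fun k => ?_, fun τ hτ => ?_⟩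
  · rw [hds, if_neg (by omega)]
    exact hsupp _ (by omega)
  · rw [hds]
    split_ifs
    · simpa using hα
    · exact hmag _
  · rcases lt_or_ge τ (t_a - i) with h | h
    · rw [conv_eq_zero_of_forall_le Φψ ds τ fun k hk => by rw [hds, if_pos (by omega)], norm_zero]
      exact hθ
    · obtain ⟨n, rfl⟩ := Nat.exists_eq_add_of_le h
      rw [conv_delay_add Φψ d (t_a - i) n ds hds]
      exact hstealth n (by omega)
end

section
/- (Tail stealthiness guarantee, Remark 2 of Section III.) Let Φψ : ℕ → Matrix (Fin q) (Fin m) ℝ be a kernel, α ≥ 0, θ ≥ 0, t_a, t_ψd ∈ ℕ. Suppose α · max_{i ∈ Fin q} ∑_{k > t_ψd} ∑_{j ∈ Fin m} |Φψ(k)ᵢⱼ| ≤ θ (the tail of the pulse response beyond t_ψd is small enough relative to α and θ), and suppose d is a signal with |d(k)| ≤ α for all k and d(k) = 0 for all k > t_a. Then |(Φψ * d)(τ)| ≤ θ for every τ > t_a + t_ψd; i.e., enforcing the monitoring constraint only up to t_a + t_ψd suffices to guarantee stealthiness for all time. -/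
/-- A matrix-vector product is bounded entrywise by the row sum times the sup norm. -/
theorem abs_mulVec_apply_le {q m : ℕ} (A : Matrix (Fin q) (Fin m) ℝ) (v : Fin m → ℝ) (i : Fin q) :
    |A.mulVec v i| ≤ ‖v‖ * ∑ j, |A i j| := by
  rw [Finset.mul_sum, Matrix.mulVec, dotProduct]
  refine (Finset.abs_sum_le_sum_abs _ _).trans (Finset.sum_le_sum fun j _ => ?_)
  rw [abs_mul, mul_comm]
  exact mul_le_mul_of_nonneg_right (norm_le_pi_norm v j) (abs_nonneg _)

/-- If `d` is supported on `{0,…,a}`, its convolution at a time `n ≥ a` is a sum over the support. -/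
theorem conv_eq_sum_of_support {q m : ℕ} (Φ : ℕ → Matrix (Fin q) (Fin m) ℝ) (d : ℕ → Fin m → ℝ)
    {a n : ℕ} (hd : ∀ k, a < k → d k = 0) (hn : a ≤ n) :
    conv Φ d n = ∑ k ∈ Finset.range (a + 1), (Φ (n - k)).mulVec (d k) := by
  refine (Finset.sum_subset (Finset.range_mono (by omega)) fun k _ hk => ?_).symm
  rw [hd k (by simpa using hk), Matrix.mulVec_zero]

/-- A window of a nonnegative series, summed in reverse order, is bounded by the tail it lies in. -/
theorem sum_range_sub_le_tsum_tail {f : ℕ → ℝ} (hf : ∀ k, 0 ≤ f k) {a t n : ℕ}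
    (hs : Summable fun k => f (k + t + 1)) (hn : a + t < n) :
    ∑ k ∈ Finset.range (a + 1), f (n - k) ≤ ∑' k, f (k + t + 1) := by
  have hinj : Set.InjOn (fun k => n - k - t - 1) (Finset.range (a + 1)) := by
    intro x hx y hy hxy
    simp only [Finset.coe_range, Set.mem_Iio] at hx hy hxy
    omega
  calc ∑ k ∈ Finset.range (a + 1), f (n - k)
      = ∑ k ∈ (Finset.range (a + 1)).image fun k => n - k - t - 1, f (k + t + 1) := by
        rw [Finset.sum_image hinj]
        refine Finset.sum_congr rfl fun k hk => ?_
        rw [Finset.mem_range] at hk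
        congr 1
        omega
    _ ≤ ∑' k, f (k + t + 1) := hs.sum_le_tsum _ fun k _ => hf _

/-- Tail stealthiness guarantee (Remark 2 of Section III): if the tail of the pulse
response beyond `t_ψd` is small enough relative to `α` and `θ`, then an attack of
magnitude at most `α` supported on `{0,…,t_a}` automatically satisfies the
monitoring constraint at every time `τ > t_a + t_ψd`. -/
theorem tail_stealthiness {q m : ℕ}
    (Φψ : ℕ → Matrix (Fin q) (Fin m) ℝ)
    (α θ : ℝ) (hα : 0 ≤ α) (hθ : 0 ≤ θ) (t_a t_ψd : ℕ)
    (hsum : ∀ i : Fin q, Summable fun k : ℕ => ∑ j, |Φψ (k + t_ψd + 1) i j|)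
    (htail : α * (⨆ i : Fin q, ∑' k : ℕ, ∑ j, |Φψ (k + t_ψd + 1) i j|) ≤ θ)
    (d : ℕ → Fin m → ℝ)
    (hmag : ∀ k, ‖d k‖ ≤ α)
    (hsupp : ∀ k, t_a < k → d k = 0) :
    ∀ τ, t_a + t_ψd < τ → ‖conv Φψ d τ‖ ≤ θ := by
  intro τ hτ
  refine (pi_norm_le_iff_of_nonneg hθ).2 fun i => ?_
  rw [conv_eq_sum_of_support Φψ d hsupp (by omega), Finset.sum_apply, Real.norm_eq_abs]
  calc |∑ k ∈ Finset.range (t_a + 1), (Φψ (τ - k)).mulVec (d k) i|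
      ≤ ∑ k ∈ Finset.range (t_a + 1), α * ∑ j, |Φψ (τ - k) i j| :=
        (Finset.abs_sum_le_sum_abs _ _).trans <| Finset.sum_le_sum fun k _ =>
          (abs_mulVec_apply_le _ _ i).trans <|
            mul_le_mul_of_nonneg_right (hmag k) (Finset.sum_nonneg fun j _ => abs_nonneg _)
    _ = α * ∑ k ∈ Finset.range (t_a + 1), ∑ j, |Φψ (τ - k) i j| := by rw [Finset.mul_sum]
    _ ≤ α * ∑' k : ℕ, ∑ j, |Φψ (k + t_ψd + 1) i j| :=
        mul_le_mul_of_nonneg_left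
          (sum_range_sub_le_tsum_tail (f := fun k => ∑ j, |Φψ k i j|)
            (fun k => Finset.sum_nonneg fun j _ => abs_nonneg _) (hsum i) hτ) hα
    _ ≤ α * ⨆ i : Fin q, ∑' k : ℕ, ∑ j, |Φψ (k + t_ψd + 1) i j| :=
        mul_le_mul_of_nonneg_left
          (le_ciSup (f := fun i => ∑' k : ℕ, ∑ j, |Φψ (k + t_ψd + 1) i j|)
            (Set.finite_range _).bddAbove i) hα
    _ ≤ θ := htail
end
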